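/- Fix n ≥ 2 and r ≥ 1. Let X be a finite set of prefix-replacement permutations of Ω, and let ω₀ = (q₀, u₀) ∈ Ω be eventually constant, i.e. there exist K : ℕ and c : Fin n with u₀ i = c for all i ≥ K. Then the language {z : List (X × Bool) | (eval z) ω₀ ≠ ω₀}, where eval is evaluation of signed words in Equiv.Perm Ω, is a context-free language. -/

import Mathlib

/-- The sequence beginning with the entries of `w` followed by `ω`. -/
def prepend {n : ℕ} (w : List (Fin n)) (ω : ℕ → Fin n) : ℕ → Fin n :=
  fun i => if h : i < w.length then w.get ⟨i, h⟩ else ω (i - w.length)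

/-- A permutation of `Ω = Fin r × (ℕ → Fin n)` is a prefix-replacement permutation if there
is a depth `k` such that it acts by replacing length-`k` prefixes. -/
def IsPrefixReplacement {n r : ℕ} (σ : Equiv.Perm (Fin r × (ℕ → Fin n))) : Prop :=
  ∃ k : ℕ, ∀ (q : Fin r) (w : List (Fin n)), w.length = k →
    ∃ (q' : Fin r) (w' : List (Fin n)), ∀ ω : ℕ → Fin n,
      σ (q, prepend w ω) = (q', prepend w' ω)

/-- Evaluation of a signed word over the alphabet `A` in the group `G`. -/
def evalWord {G A : Type*} [Group G] (f : A → G) (w : List (A × Bool)) : G :=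
  (w.map fun p => if p.2 then f p.1 else (f p.1)⁻¹).prod

section PushdownRun

variable {T Q Γ : Type*}

/-- `PushdownRun δ p γ z q`: the pushdown automaton with transitions `δ` can go from state `p` with
stack `γ` to state `q` with empty stack while reading `z`. -/
inductive PushdownRun (δ : Q → Γ → Set (List T × Q × List Γ)) :
    Q → List Γ → List T → Q → Prop
  | nil (p : Q) : PushdownRun δ p [] [] p
  | step {p p' q : Q} {A : Γ} {t z : List T} {β γ : List Γ} (h : (t, p', β) ∈ δ p A)
      (hrun : PushdownRun δ p' (β ++ γ) z q) : PushdownRun δ p (A :: γ) (t ++ z) q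

theorem PushdownRun.append {δ : Q → Γ → Set (List T × Q × List Γ)} {p q q' : Q}
    {α β : List Γ} {y z : List T} (h : PushdownRun δ p α y q) (h' : PushdownRun δ q β z q') :
    PushdownRun δ p (α ++ β) (y ++ z) q' := by
  induction h with
  | nil p => simpa using h'
  | step hδ _ ih =>
    rw [List.append_assoc]
    exact .step hδ (by simpa [List.append_assoc] using ih h')

/-- The sentential forms `[p, B₁, q₁] [q₁, B₂, q₂] ⋯ [qₘ₋₁, Bₘ, q]` for a stack `B₁ ⋯ Bₘ`. -/
def tripleChains (T : Type*) {Q Γ : Type*} :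
    Q → List Γ → Q → Set (List (Symbol T (Q × Γ × Q)))
  | p, [], q => {o | o = [] ∧ p = q}
  | p, B :: β, q =>
    ⋃ q₁ : Q, (fun o => Symbol.nonterminal (p, B, q₁) :: o) '' tripleChains T q₁ β q

theorem finite_tripleChains [Finite Q] (p : Q) (β : List Γ) (q : Q) :
    (tripleChains T p β q).Finite := by
  induction β generalizing p with
  | nil => exact (Set.finite_singleton []).subset fun o ho => ho.1
  | cons B β ih => exact Set.finite_iUnion fun q₁ => (ih q₁).image _

theorem exists_of_mem_tripleChains_append {p q : Q} {β γ : List Γ}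
    {o : List (Symbol T (Q × Γ × Q))} (h : o ∈ tripleChains T p (β ++ γ) q) :
    ∃ q₁, ∃ o₁ ∈ tripleChains T p β q₁, ∃ o₂ ∈ tripleChains T q₁ γ q, o = o₁ ++ o₂ := by
  induction β generalizing p o with
  | nil => exact ⟨p, [], ⟨rfl, rfl⟩, o, h, rfl⟩
  | cons B β ih =>
    simp only [List.cons_append, tripleChains, Set.mem_iUnion, Set.mem_image] at h
    obtain ⟨q', o', ho', rfl⟩ := h
    obtain ⟨q₁, o₁, h₁, o₂, h₂, rfl⟩ := ih ho'
    refine ⟨q₁, Symbol.nonterminal (p, B, q') :: o₁, ?_, o₂, h₂, rfl⟩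
    simp only [tripleChains, Set.mem_iUnion, Set.mem_image]
    exact ⟨q', o₁, h₁, rfl⟩

/-- The rules `[p, A, q] → t [p', B₁, q₁] ⋯ [qₘ₋₁, Bₘ, q]` of the triple construction. -/
def tripleRules (δ : Q → Γ → Set (List T × Q × List Γ)) :
    Set (ContextFreeRule T (Q × Γ × Q)) :=
  ⋃ (p : Q) (A : Γ) (q : Q), ⋃ x ∈ δ p A,
    (fun o => ⟨(p, A, q), x.1.map Symbol.terminal ++ o⟩) '' tripleChains T x.2.1 x.2.2 q

theorem finite_tripleRules [Finite Q] [Finite Γ] {δ : Q → Γ → Set (List T × Q × List Γ)}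
    (hδ : ∀ p A, (δ p A).Finite) : (tripleRules δ).Finite :=
  Set.finite_iUnion fun p => Set.finite_iUnion fun A => Set.finite_iUnion fun _ =>
    (hδ p A).biUnion fun _ _ => (finite_tripleChains _ _ _).image _

end PushdownRun

namespace ContextFreeGrammar

variable {T : Type*}

/-- The language denoted by a symbol, given languages for the nonterminals. -/
def symbolLanguage {N : Type*} (sem : N → Language T) : Symbol T N → Language T
  | .terminal t => {[t]}
  | .nonterminal A => sem A

theorem prod_symbolLanguage_terminal {N : Type*} (sem : N → Language T) (z : List T) :
    z ∈ ((z.map Symbol.terminal).map (symbolLanguage sem)).prod := by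
  induction z with
  | nil => simp [Language.mem_one]
  | cons a z ih =>
    simp only [List.map_cons, List.prod_cons]
    exact Language.mem_mul.2 ⟨[a], rfl, z, ih, rfl⟩

theorem eq_append_of_mem_prod {N : Type*} {sem : N → Language T} {t z : List T}
    {o : List (Symbol T N)}
    (h : z ∈ ((t.map Symbol.terminal ++ o).map (symbolLanguage sem)).prod) :
    ∃ y ∈ (o.map (symbolLanguage sem)).prod, z = t ++ y := by
  induction t generalizing z with
  | nil => exact ⟨z, by simpa using h, rfl⟩
  | cons a t ih =>
    simp only [List.map_cons, List.cons_append, List.prod_cons] at h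
    obtain ⟨x, hx, y, hy, rfl⟩ := Language.mem_mul.1 h
    obtain ⟨y', hy', rfl⟩ := ih hy
    obtain rfl : x = [a] := hx
    exact ⟨y', hy', rfl⟩

theorem Derives.prod_symbolLanguage_le {g : ContextFreeGrammar T} {sem : g.NT → Language T}
    (hsem : ∀ r ∈ g.rules, (r.output.map (symbolLanguage sem)).prod ≤ sem r.input)
    {u v : List (Symbol T g.NT)} (h : g.Derives u v) :
    (v.map (symbolLanguage sem)).prod ≤ (u.map (symbolLanguage sem)).prod := by
  induction h with
  | refl => exact le_rfl
  | tail _ hp ih =>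
    refine le_trans ?_ ih
    obtain ⟨r, hr, hrw⟩ := hp
    obtain ⟨a, b, rfl, rfl⟩ := hrw.exists_parts
    simp only [List.map_append, List.prod_append, List.map_cons, List.map_nil, List.prod_cons,
      List.prod_nil, mul_one]
    exact mul_le_mul' (mul_le_mul' le_rfl (hsem r hr)) le_rfl

theorem language_le {g : ContextFreeGrammar T} {sem : g.NT → Language T}
    (hsem : ∀ r ∈ g.rules, (r.output.map (symbolLanguage sem)).prod ≤ sem r.input) :
    g.language ≤ sem g.initial := by
  intro z hz
  have h := Derives.prod_symbolLanguage_le hsem hz (prod_symbolLanguage_terminal sem z)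
  simpa [symbolLanguage] using h

end ContextFreeGrammar

/-- The language accepted by a pushdown automaton by empty stack in a given final state is
context-free. -/
theorem isContextFree_pushdownRun {T : Type*} {Q Γ : Type} [Finite Q] [Finite Γ]
    {δ : Q → Γ → Set (List T × Q × List Γ)} (hδ : ∀ p A, (δ p A).Finite) (p₀ qf : Q) (A₀ : Γ) :
    Language.IsContextFree {z : List T | PushdownRun δ p₀ [A₀] z qf} := by
  let g : ContextFreeGrammar T :=
    ⟨Q × Γ × Q, (p₀, A₀, qf), (finite_tripleRules hδ).toFinset⟩
  let sem : Q × Γ × Q → Language T := fun x => {z | PushdownRun δ x.1 [x.2.1] z x.2.2}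
  have chain_run : ∀ (β : List Γ) (p q : Q), ∀ o ∈ tripleChains T p β q,
      ∀ z ∈ (o.map (ContextFreeGrammar.symbolLanguage sem)).prod, PushdownRun δ p β z q := by
    intro β
    induction β with
    | nil =>
      rintro p q o ⟨rfl, rfl⟩ z hz
      obtain rfl : z = [] := by simpa [Language.mem_one] using hz
      exact .nil p
    | cons B β ih =>
      intro p q o ho z hz
      simp only [tripleChains, Set.mem_iUnion, Set.mem_image] at ho
      obtain ⟨q₁, o, ho, rfl⟩ := ho
      simp only [List.map_cons, List.prod_cons] at hz
      obtain ⟨x, hx, y, hy, rfl⟩ := Language.mem_mul.1 hz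
      exact PushdownRun.append (α := [B]) hx (ih q₁ q o ho y hy)
  have run_chain : ∀ (p q : Q) (γ : List Γ) (z : List T), PushdownRun δ p γ z q →
      ∃ o ∈ tripleChains T p γ q, g.Derives o (z.map Symbol.terminal) := by
    intro p q γ z h
    induction h with
    | nil p => exact ⟨[], ⟨rfl, rfl⟩, ContextFreeGrammar.Derives.refl (g := g) []⟩
    | @step p p' q A t z β γ hmem _ ih =>
      obtain ⟨o, ho, hd⟩ := ih
      obtain ⟨q₁, o₁, h₁, o₂, h₂, rfl⟩ := exists_of_mem_tripleChains_append ho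
      refine ⟨Symbol.nonterminal (p, A, q₁) :: o₂, ?_, ?_⟩
      · simp only [tripleChains, Set.mem_iUnion, Set.mem_image]
        exact ⟨q₁, o₂, h₂, rfl⟩
      · have hr : (⟨(p, A, q₁), t.map Symbol.terminal ++ o₁⟩ :
            ContextFreeRule T (Q × Γ × Q)) ∈ g.rules := by
          simp only [g, Set.Finite.mem_toFinset, tripleRules, Set.mem_iUnion]
          exact ⟨p, A, q₁, _, hmem, o₁, h₁, rfl⟩
        have hp : g.Produces (Symbol.nonterminal (p, A, q₁) :: o₂)
            ((t.map Symbol.terminal ++ o₁) ++ o₂) := ⟨_, hr, .head o₂⟩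
        refine hp.trans_derives ?_
        rw [List.append_assoc, List.map_append]
        exact hd.append_left _
  refine ⟨g, le_antisymm (ContextFreeGrammar.language_le (g := g) (sem := sem) ?_) ?_⟩
  · intro r hr
    simp only [g, Set.Finite.mem_toFinset, tripleRules, Set.mem_iUnion] at hr
    obtain ⟨p, A, q, ⟨t, p', β⟩, hmem, o, ho, rfl⟩ := hr
    intro z hz
    obtain ⟨y, hy, rfl⟩ := ContextFreeGrammar.eq_append_of_mem_prod hz
    exact PushdownRun.step (γ := []) hmem (by simpa using chain_run β p' q o ho y hy)
  · intro z hz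
    obtain ⟨o, ho, hd⟩ := run_chain _ _ _ _ hz
    simp only [tripleChains, Set.mem_iUnion, Set.mem_image] at ho
    obtain ⟨q₁, _, ⟨rfl, rfl⟩, rfl⟩ := ho
    exact hd

section Prepend

variable {n : ℕ}

@[simp]
theorem prepend_nil (ω : ℕ → Fin n) : prepend [] ω = ω := by
  funext i
  simp [prepend]

theorem prepend_append (u v : List (Fin n)) (ω : ℕ → Fin n) :
    prepend (u ++ v) ω = prepend u (prepend v ω) := by
  funext i
  simp only [prepend, List.length_append, List.get_eq_getElem, List.getElem_append]
  split_ifs <;> first | rfl | omega | (congr 1; omega)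

theorem prepend_inj {v w : List (Fin n)} {ω η : ℕ → Fin n} (hl : v.length = w.length)
    (h : prepend v ω = prepend w η) : v = w ∧ ω = η := by
  constructor
  · refine List.ext_getElem hl fun i h₁ h₂ => ?_
    simpa [prepend, h₁, h₂] using congrFun h i
  · funext i
    simpa [prepend, hl] using congrFun h (i + w.length)

theorem prepend_ofFn (k : ℕ) (ω : ℕ → Fin n) :
    prepend (List.ofFn fun i : Fin k => ω i) (fun i => ω (i + k)) = ω := by
  funext i
  by_cases h : i < k
  · simp [prepend, h]
  · simp only [prepend, List.length_ofFn, h, dite_false]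
    congr 1
    omega

theorem exists_eq_append_of_prepend_eq {v w : List (Fin n)} {ω η : ℕ → Fin n}
    (hl : w.length ≤ v.length) (h : prepend v ω = prepend w η) : ∃ t, v = w ++ t := by
  refine ⟨v.drop w.length, ?_⟩
  rw [← List.take_append_drop w.length v, prepend_append] at h
  have := (prepend_inj (by simpa using hl) h).1
  conv_lhs => rw [← List.take_append_drop w.length v, this]

theorem prepend_replicate_const (m : ℕ) (c : Fin n) :
    prepend (List.replicate m c) (fun _ => c) = fun _ => c := by
  funext i
  simp [prepend]

end Prepend

/-- A self-map of `Fin r × (ℕ → Fin n)` acting by replacing prefixes of length `k`. -/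
def ReplacesPrefixes {n r : ℕ} (k : ℕ)
    (f : Fin r × (ℕ → Fin n) → Fin r × (ℕ → Fin n)) : Prop :=
  ∀ (q : Fin r) (w : List (Fin n)), w.length = k →
    ∃ (q' : Fin r) (w' : List (Fin n)), ∀ ω : ℕ → Fin n,
      f (q, prepend w ω) = (q', prepend w' ω)

theorem ReplacesPrefixes.mono {n r k l : ℕ} {f : Fin r × (ℕ → Fin n) → Fin r × (ℕ → Fin n)}
    (h : ReplacesPrefixes k f) (hkl : k ≤ l) : ReplacesPrefixes l f := by
  intro q w hw
  obtain ⟨q', w', h'⟩ := h q (w.take k) (by simp; omega)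
  refine ⟨q', w' ++ w.drop k, fun ω => ?_⟩
  conv_lhs => rw [← List.take_append_drop k w]
  rw [prepend_append, h', prepend_append]

theorem IsPrefixReplacement.inv {n r : ℕ} {σ : Equiv.Perm (Fin r × (ℕ → Fin n))}
    (h : IsPrefixReplacement σ) : IsPrefixReplacement σ⁻¹ := by
  obtain ⟨k, h⟩ := h
  choose Q W hQW using h
  have hbound : ∃ B, ∀ (q : Fin r) (f : Fin k → Fin n),
      (W q (List.ofFn f) (by simp)).length ≤ B := by
    obtain ⟨B, hB⟩ := (Set.finite_range fun x : Fin r × (Fin k → Fin n) =>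
      (W x.1 (List.ofFn x.2) (by simp)).length).bddAbove
    exact ⟨B, fun q f => hB ⟨(q, f), rfl⟩⟩
  obtain ⟨B, hB⟩ := hbound
  refine ⟨B, fun p v hv => ?_⟩
  by_cases hne : Nonempty (Fin n)
  swap
  · exact ⟨p, v, fun ω => (hne ⟨ω 0⟩).elim⟩
  obtain ⟨c⟩ := hne
  obtain ⟨⟨q, u⟩, hu⟩ := σ.surjective (p, prepend v fun _ => c)
  rw [← prepend_ofFn k u, hQW _ _ (by simp), Prod.mk.injEq] at hu
  obtain ⟨t, ht⟩ := exists_eq_append_of_prepend_eq (by rw [hv]; exact hB _ _) hu.2.symm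
  refine ⟨q, (List.ofFn fun i : Fin k => u i) ++ t, fun ω => ?_⟩
  rw [Equiv.Perm.inv_eq_iff_eq, prepend_append, hQW _ _ (by simp), ← prepend_append, ← ht, hu.1]

section MovingAutomaton

variable {n r k : ℕ} {T : Type*}

/-- States of the pushdown automaton: a point of `Fin r` with a buffer of at most `k` letters, or
one of the final-phase states `inr false` (searching for a letter other than `c`) and `inr true`
(accepting). -/
abbrev MovingState (n r k : ℕ) : Type := (Fin r × {l : List (Fin n) // l.length ≤ k}) ⊕ Bool

instance (n k : ℕ) : Finite {l : List (Fin n) // l.length ≤ k} :=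
  (List.finite_length_le (Fin n) k).to_subtype

open Classical in
/-- Transitions of the pushdown automaton simulating prefix replacements given by the table `tab`.
The bottom symbol `none` stands for the sequence constantly equal to `c`. -/
noncomputable def movingTransition (tab : T → Fin r → List (Fin n) → Fin r × List (Fin n))
    (c : Fin n) (q₀ : Fin r) (w₀ : List (Fin n)) :
    MovingState n r k → Option (Fin n) →
      Set (List T × MovingState n r k × List (Option (Fin n)))
  | p, none => {([], p, [some c, none])} ∪ {x | x = ([], p, []) ∧ p = .inr true}
  | .inr true, some _ => {([], .inr true, [])}
  | .inr false, some b => {([], .inr (decide (b ≠ c)), [])}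
  | .inl (q, buf), some b =>
    if h : buf.1.length < k then
      {([], .inl (q, ⟨buf.1 ++ [b], by simp; omega⟩), [])}
    else
      Set.range (fun a => ([a], .inl ((tab a q buf.1).1, ⟨[], by simp⟩),
        (tab a q buf.1).2.map some ++ [some b])) ∪
      {([], .inr (decide ((q, buf.1) ≠ (q₀, w₀))), [some b])}

variable {tab : T → Fin r → List (Fin n) → Fin r × List (Fin n)} {c : Fin n} {q₀ : Fin r}
  {w₀ : List (Fin n)}

theorem finite_movingTransition [Finite T] (p : MovingState n r k) (A : Option (Fin n)) :
    (movingTransition tab c q₀ w₀ p A).Finite := by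
  match p, A with
  | p, none =>
    exact (Set.finite_singleton _).union
      ((Set.finite_singleton ([], p, [])).subset fun x hx => hx.1)
  | .inr true, some _ => exact Set.finite_singleton _
  | .inr false, some b => exact Set.finite_singleton _
  | .inl (q, buf), some b =>
    simp only [movingTransition]
    split_ifs
    · exact Set.finite_singleton _
    · exact (Set.finite_range _).union (Set.finite_singleton _)

/-- The sequence represented by a stack. -/
def stackSequence (c : Fin n) : List (Option (Fin n)) → ℕ → Fin n
  | [] => fun _ => c
  | none :: _ => fun _ => c
  | some b :: γ => prepend [b] (stackSequence c γ)

theorem stackSequence_map_some_append (w : List (Fin n)) (γ : List (Option (Fin n))) :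
    stackSequence c (w.map some ++ γ) = prepend w (stackSequence c γ) := by
  induction w with
  | nil => simp
  | cons b w ih =>
    rw [List.map_cons, List.cons_append, stackSequence, ih, ← prepend_append]
    rfl

theorem prepend_singleton_const (c : Fin n) : prepend [c] (fun _ => c) = fun _ => c :=
  prepend_replicate_const 1 c

variable {f : T → Fin r × (ℕ → Fin n) → Fin r × (ℕ → Fin n)}

/-- The property of inputs guaranteed by an accepting run from a given state and stack. -/
def MovingSpec (f : T → Fin r × (ℕ → Fin n) → Fin r × (ℕ → Fin n)) (c : Fin n)
    (ω₀ : Fin r × (ℕ → Fin n)) (γ : List (Option (Fin n))) (y : List T) :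
    MovingState n r k → Prop
  | .inl (q, buf) => y.foldl (fun ω a => f a ω) (q, prepend buf.1 (stackSequence c γ)) ≠ ω₀
  | .inr false => y = [] ∧ stackSequence c γ ≠ fun _ => c
  | .inr true => y = []

theorem movingSpec_of_pushdownRun
    (hf : ∀ a q w, w.length = k → ∀ ω, f a (q, prepend w ω) =
      ((tab a q w).1, prepend (tab a q w).2 ω)) (hw₀ : w₀.length = k)
    {p qf : MovingState n r k} {γ : List (Option (Fin n))} {y : List T}
    (h : PushdownRun (movingTransition tab c q₀ w₀) p γ y qf) (hqf : qf = .inr true) :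
    MovingSpec f c (q₀, prepend w₀ fun _ => c) γ y p := by
  induction h with
  | nil p => subst hqf; rfl
  | @step p p' q A t z β γ hmem _ ih =>
    specialize ih hqf
    match p, A with
    | p, none =>
      rcases hmem with h | ⟨h, rfl⟩
      · obtain ⟨rfl, rfl, rfl⟩ : t = [] ∧ p' = p ∧ β = [some c, none] := by simpa using h
        have hs : stackSequence c ([some c, none] ++ γ) = stackSequence c (none :: γ) :=
          prepend_singleton_const c
        match p', ih with
        | .inl (q, buf), ih => simpa only [MovingSpec, hs, List.nil_append] using ih
        | .inr false, ih => simpa only [MovingSpec, hs, List.nil_append] using ih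
        | .inr true, ih => exact ih
      · obtain ⟨rfl, rfl, rfl⟩ : t = [] ∧ p' = .inr true ∧ β = [] := by simpa using h
        exact ih
    | .inr true, some b =>
      obtain ⟨rfl, rfl, rfl⟩ : t = [] ∧ p' = .inr true ∧ β = [] := by
        simpa [movingTransition] using hmem
      exact ih
    | .inr false, some b =>
      obtain ⟨rfl, rfl, rfl⟩ : t = [] ∧ p' = .inr (decide (b ≠ c)) ∧ β = [] := by
        simpa [movingTransition] using hmem
      by_cases hb : b = c
      · subst hb
        simp only [ne_eq, not_true, decide_false, MovingSpec, List.nil_append] at ih ⊢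
        refine ⟨ih.1, fun h => ih.2 ?_⟩
        rw [stackSequence] at h
        exact (prepend_inj (v := [b]) (w := [b]) rfl (h.trans (prepend_singleton_const b).symm)).2
      · simp only [ne_eq, hb, not_false_eq_true, decide_true, MovingSpec] at ih ⊢
        refine ⟨ih, fun h => hb ?_⟩
        simpa [stackSequence, prepend] using congrFun h 0
    | .inl (q, buf), some b =>
      simp only [movingTransition] at hmem
      split_ifs at hmem with hlen
      · obtain ⟨rfl, rfl, rfl⟩ : t = [] ∧ p' = .inl (q, ⟨buf.1 ++ [b], by simp; omega⟩) ∧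
          β = [] := by simpa using hmem
        simpa [MovingSpec, prepend_append, stackSequence] using ih
      · have hk : buf.1.length = k := le_antisymm buf.2 (not_lt.1 hlen)
        rcases hmem with ⟨a, ha⟩ | h
        · simp only [Prod.mk.injEq] at ha
          obtain ⟨rfl, rfl, rfl⟩ := ha
          simp only [MovingSpec, List.append_assoc, stackSequence_map_some_append,
            prepend_nil] at ih
          simpa [MovingSpec, hf a q buf.1 hk] using ih
        · obtain ⟨rfl, rfl, rfl⟩ : t = [] ∧ p' = .inr (decide ((q, buf.1) ≠ (q₀, w₀))) ∧
            β = [some b] := by simpa using h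
          by_cases he : (q, buf.1) = (q₀, w₀)
          · simp only [he, ne_eq, not_true, decide_false, MovingSpec] at ih ⊢
            obtain ⟨rfl, ih⟩ := ih
            intro h
            simp only [List.nil_append, List.foldl_nil, Prod.mk.injEq] at h he
            rw [he.2] at h
            exact ih (prepend_inj rfl h.2).2
          · simp only [he, ne_eq, not_false_eq_true, decide_true, MovingSpec] at ih ⊢
            subst ih
            intro h
            simp only [List.nil_append, List.foldl_nil, Prod.mk.injEq] at h he
            exact he ⟨h.1, (prepend_inj (hk.trans hw₀.symm) h.2).1⟩

/-- The stack with entries `v` above the bottom symbol. -/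
def bottomedStack (v : List (Fin n)) : List (Option (Fin n)) := v.map some ++ [none]

theorem pushdownRun_accepting (v : List (Fin n)) :
    PushdownRun (movingTransition (k := k) tab c q₀ w₀) (.inr true) (bottomedStack v) []
      (.inr true) := by
  induction v with
  | nil => exact .step (t := []) (β := []) (γ := []) (Or.inr ⟨rfl, rfl⟩) (.nil _)
  | cons b v ih =>
    exact .step (t := []) (p' := .inr true) (β := []) (by simp [movingTransition]) ih

theorem pushdownRun_searching {v : List (Fin n)} (hv : prepend v (fun _ => c) ≠ fun _ => c) :
    PushdownRun (movingTransition (k := k) tab c q₀ w₀) (.inr false) (bottomedStack v) []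
      (.inr true) := by
  induction v with
  | nil => simp at hv
  | cons b v ih =>
    refine .step (t := []) (p' := .inr (decide (b ≠ c))) (β := [])
      (by simp [movingTransition]) ?_
    by_cases hb : b = c
    · subst hb
      simp only [ne_eq, not_true, decide_false]
      refine ih fun h => hv ?_
      rw [← List.singleton_append, prepend_append, h, prepend_singleton_const]
    · rw [decide_eq_true hb]
      exact pushdownRun_accepting v

/-- Unfolding the bottom symbol if necessary, a letter is available on top of the stack. -/
theorem exists_cons_stack (c : Fin n) (v : List (Fin n)) :
    ∃ b v', prepend v (fun _ => c) = prepend (b :: v') (fun _ => c) ∧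
      ∀ {tab : T → Fin r → List (Fin n) → Fin r × List (Fin n)} {q₀ : Fin r}
        {w₀ : List (Fin n)} {p q : MovingState n r k} {y : List T},
        PushdownRun (movingTransition tab c q₀ w₀) p (bottomedStack (b :: v')) y q →
        PushdownRun (movingTransition tab c q₀ w₀) p (bottomedStack v) y q := by
  cases v with
  | nil =>
    refine ⟨c, [], by rw [prepend_singleton_const, prepend_nil], fun h => ?_⟩
    exact .step (t := []) (β := [some c, none]) (γ := []) (Or.inl rfl) h
  | cons b v => exact ⟨b, v, rfl, id⟩

/-- The buffer can be filled up to length `k`. -/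
theorem exists_full_buffer (tab : T → Fin r → List (Fin n) → Fin r × List (Fin n)) (c : Fin n)
    (q₀ : Fin r) (w₀ : List (Fin n)) (q : Fin r) (buf : {l : List (Fin n) // l.length ≤ k})
    (v : List (Fin n)) :
    ∃ (w : {l : List (Fin n) // l.length ≤ k}) (b : Fin n) (v' : List (Fin n)),
      w.1.length = k ∧
      prepend buf.1 (prepend v fun _ => c) = prepend w.1 (prepend (b :: v') fun _ => c) ∧
      ∀ (y : List T) (qf : MovingState n r k),
        PushdownRun (movingTransition tab c q₀ w₀) (.inl (q, w)) (bottomedStack (b :: v')) y qf →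
        PushdownRun (movingTransition tab c q₀ w₀) (.inl (q, buf)) (bottomedStack v) y qf := by
  obtain ⟨b, v', hv, hrun⟩ := exists_cons_stack (T := T) (r := r) (k := k) c v
  by_cases hlen : buf.1.length < k
  · obtain ⟨w, b', v'', hw, hs, hrun'⟩ :=
      exists_full_buffer tab c q₀ w₀ q ⟨buf.1 ++ [b], by simp; omega⟩ v'
    refine ⟨w, b', v'', hw, ?_, fun y qf h => hrun ?_⟩
    · rw [← hs, hv, prepend_append, ← prepend_append [b]]
      rfl
    · refine .step (t := []) (β := []) ?_ (hrun' y qf h)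
      simp [movingTransition, hlen]
  · exact ⟨buf, b, v', by omega, by rw [hv], fun y qf h => hrun h⟩
termination_by k - buf.1.length
decreasing_by simp; omega

theorem pushdownRun_of_foldl_ne
    (hf : ∀ a q w, w.length = k → ∀ ω, f a (q, prepend w ω) =
      ((tab a q w).1, prepend (tab a q w).2 ω)) (y : List T) (q : Fin r)
    (buf : {l : List (Fin n) // l.length ≤ k}) (v : List (Fin n))
    (h : y.foldl (fun ω a => f a ω) (q, prepend buf.1 (prepend v fun _ => c)) ≠
      (q₀, prepend w₀ fun _ => c)) :
    PushdownRun (movingTransition tab c q₀ w₀) (.inl (q, buf)) (bottomedStack v) y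
      (.inr true) := by
  induction y generalizing q buf v with
  | nil =>
    obtain ⟨w, b, v', hw, hs, hrun⟩ := exists_full_buffer tab c q₀ w₀ q buf v
    refine hrun _ _ ?_
    rw [hs] at h
    refine .step (t := []) (p' := .inr (decide ((q, w.1) ≠ (q₀, w₀)))) (β := [some b]) ?_ ?_
    · simp only [movingTransition, hw, lt_irrefl, dite_false]
      exact Or.inr rfl
    · by_cases he : (q, w.1) = (q₀, w₀)
      · simp only [he, ne_eq, not_true, decide_false]
        refine pushdownRun_searching (v := b :: v') fun hc => h ?_
        simp only [Prod.mk.injEq] at he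
        rw [hc, he.1, he.2, List.foldl_nil]
      · rw [decide_eq_true he]
        exact pushdownRun_accepting (b :: v')
  | cons a y ih =>
    obtain ⟨w, b, v', hw, hs, hrun⟩ := exists_full_buffer tab c q₀ w₀ q buf v
    refine hrun _ _ ?_
    rw [hs, List.foldl_cons, hf a q w.1 hw, ← prepend_append] at h
    refine .step (t := [a]) (p' := .inl ((tab a q w.1).1, ⟨[], by simp⟩))
      (β := (tab a q w.1).2.map some ++ [some b]) ?_ ?_
    · simp only [movingTransition, hw, lt_irrefl, dite_false]
      exact Or.inl ⟨a, rfl⟩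
    · have := ih _ ⟨[], by simp⟩ _ (by simpa using h)
      simpa [bottomedStack] using this

end MovingAutomaton

/-- If finitely many letters act by replacing prefixes of length `k`, then the words moving a point
whose entries are constant from position `k` on form a context-free language. -/
theorem isContextFree_foldl_ne {n r k : ℕ} {T : Type*} [Finite T]
    {f : T → Fin r × (ℕ → Fin n) → Fin r × (ℕ → Fin n)} (hf : ∀ a, ReplacesPrefixes k (f a))
    (q₀ : Fin r) (c : Fin n) {w₀ : List (Fin n)} (hw₀ : w₀.length = k) :
    Language.IsContextFree {y : List T |
      y.foldl (fun ω a => f a ω) (q₀, prepend w₀ fun _ => c) ≠ (q₀, prepend w₀ fun _ => c)} := by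
  have htab : ∀ a q w, ∃ x : Fin r × List (Fin n), w.length = k → ∀ ω, f a (q, prepend w ω) =
      (x.1, prepend x.2 ω) := by
    intro a q w
    by_cases hw : w.length = k
    · obtain ⟨q', w', h⟩ := hf a q w hw
      exact ⟨(q', w'), fun _ => h⟩
    · exact ⟨(q, w), fun h => (hw h).elim⟩
  choose tab htab using htab
  refine (congrArg Language.IsContextFree (Set.ext fun y => ?_)).mpr
    (isContextFree_pushdownRun (δ := movingTransition (k := k) tab c q₀ w₀)
      finite_movingTransition (.inl (q₀, ⟨w₀, hw₀.le⟩)) (.inr true) none)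
  constructor
  · intro h
    exact pushdownRun_of_foldl_ne htab y q₀ ⟨w₀, hw₀.le⟩ [] (by simpa using h)
  · intro h
    exact movingSpec_of_pushdownRun htab hw₀ h rfl

theorem evalWord_apply_eq_foldr {A Ω : Type*} (g : A → Equiv.Perm Ω) (z : List (A × Bool))
    (ω : Ω) :
    evalWord g z ω =
      z.foldr (fun p ω => (if p.2 then g p.1 else (g p.1)⁻¹ : Equiv.Perm Ω) ω) ω := by
  induction z with
  | nil => rfl
  | cons p z ih =>
    rw [List.foldr_cons, ← ih]
    rfl

theorem language_moving_eventually_constant_contextFree (n r : ℕ) (hn : 2 ≤ n) (hr : 1 ≤ r)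
    (X : Finset (Equiv.Perm (Fin r × (ℕ → Fin n))))
    (hX : ∀ x ∈ X, IsPrefixReplacement x)
    (q₀ : Fin r) (u₀ : ℕ → Fin n)
    (hu₀ : ∃ (K : ℕ) (c : Fin n), ∀ i : ℕ, K ≤ i → u₀ i = c) :
    Language.IsContextFree
      {z : List (X × Bool) |
        (evalWord (fun x : X => (x : Equiv.Perm (Fin r × (ℕ → Fin n)))) z) (q₀, u₀)
          ≠ (q₀, u₀)} := by
  obtain ⟨K, c, hc⟩ := hu₀
  let f : X × Bool → Equiv.Perm (Fin r × (ℕ → Fin n)) := fun p =>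
    if p.2 then (p.1 : Equiv.Perm _) else (p.1 : Equiv.Perm _)⁻¹
  have hf : ∀ a, ∃ k, ReplacesPrefixes k (f a) := by
    rintro ⟨x, b⟩
    cases b
    · exact (hX x x.2).inv
    · exact hX x x.2
  choose depth hdepth using hf
  obtain ⟨B, hB⟩ := (Set.finite_range depth).bddAbove
  have hu : prepend (List.ofFn fun i : Fin (max B K) => u₀ i) (fun _ => c) = u₀ := by
    conv_rhs => rw [← prepend_ofFn (max B K) u₀]
    congr 1
    funext i
    exact (hc _ (by omega)).symm
  have h := isContextFree_foldl_ne (f := fun a => f a)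
    (fun a => (hdepth a).mono ((hB ⟨a, rfl⟩).trans (le_max_left B K))) q₀ c
    (w₀ := List.ofFn fun i : Fin (max B K) => u₀ i) (by simp)
  rw [hu] at h
  refine (congrArg Language.IsContextFree (Set.ext fun z => ?_)).mpr h.reverse
  refine Iff.trans ?_ Language.mem_reverse.symm
  change _ ≠ _ ↔ _ ≠ _
  rw [evalWord_apply_eq_foldr, List.foldl_reverse]
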